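/- arXiv:2602.19692 — 2 statements merged into one kernel-verified Lean document; each statement's English description precedes it below -/
import Mathlib

section
/- Let α > 0 and let β be a C¹ function on ℝ with β(t+2π) = β(t) for all t and ∫₀^{2π} β(s) ds < 0. The unique 2π-periodic solution y(t) = α∫_t^{t+2π} exp(∫_s^t β(τ)dτ) ds / (exp(−∫₀^{2π} β(s)ds) − 1) of ẏ = α + β(t)y satisfies, for all t, 2πα exp(−∫₀^{2π} β⁺(τ)dτ)/(exp(−∫₀^{2π} β(s)ds) − 1) ≤ y(t) ≤ 2πα exp(∫₀^{2π} β⁻(τ)dτ)/(exp(−∫₀^{2π} β(s)ds) − 1), where β⁻(s) := max{0,−β(s)} and β⁺(s) := max{0,β(s)}. -/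
set_option autoImplicit false

open Real MeasureTheory intervalIntegral

/-- Over at most one period, the integral of a continuous periodic function is bounded by the
integral of its positive part over a full period. -/
theorem integral_le_integral_posPart_of_periodic {γ : ℝ → ℝ} {T s t : ℝ} (hγ : Continuous γ)
    (hper : Function.Periodic γ T) (hts : t ≤ s) (hsT : s ≤ t + T) :
    ∫ τ in t..s, γ τ ≤ ∫ τ in (0:ℝ)..T, max 0 (γ τ) := by
  have hpos : Continuous fun τ => max 0 (γ τ) := continuous_const.max hγ
  have hposper : Function.Periodic (fun τ => max 0 (γ τ)) T := fun τ => by simp only [hper τ]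
  calc ∫ τ in t..s, γ τ
      ≤ ∫ τ in t..s, max 0 (γ τ) :=
        integral_mono_on hts (hγ.intervalIntegrable _ _) (hpos.intervalIntegrable _ _)
          fun τ _ => le_max_right _ _
    _ ≤ ∫ τ in t..(t + T), max 0 (γ τ) :=
        integral_mono_interval le_rfl hts hsT (Filter.Eventually.of_forall fun τ => le_max_left _ _)
          (hpos.intervalIntegrable _ _)
    _ = ∫ τ in (0:ℝ)..T, max 0 (γ τ) := by
        simpa using hposper.intervalIntegral_add_eq t 0

/-- Bounds on the unique `2π`-periodic solution
`y t = α ∫_t^{t+2π} exp (∫_s^t β) ds / (exp (−∫₀^{2π} β) − 1)` of `ẏ = α + β t * y`: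
for all `t`,
`2πα exp (−∫₀^{2π} β⁺) / (exp (−∫₀^{2π} β) − 1) ≤ y t ≤
 2πα exp (∫₀^{2π} β⁻) / (exp (−∫₀^{2π} β) − 1)`,
where `β⁻ s = max 0 (−β s)` and `β⁺ s = max 0 (β s)`. -/
theorem periodic_solution_affine_ode_bounds
    (α : ℝ) (hα : 0 < α)
    (β : ℝ → ℝ) (hβ : ContDiff ℝ 1 β)
    (hper : ∀ t : ℝ, β (t + 2 * π) = β t)
    (hneg : (∫ s in (0:ℝ)..(2 * π), β s) < 0)
    (y : ℝ → ℝ)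
    (hy : ∀ t : ℝ, y t = α * (∫ s in t..(t + 2 * π), Real.exp (∫ τ in s..t, β τ)) /
      (Real.exp (-(∫ s in (0:ℝ)..(2 * π), β s)) - 1)) :
    ∀ t : ℝ,
      2 * π * α * Real.exp (-(∫ τ in (0:ℝ)..(2 * π), max 0 (β τ))) /
          (Real.exp (-(∫ s in (0:ℝ)..(2 * π), β s)) - 1) ≤ y t ∧
      y t ≤ 2 * π * α * Real.exp (∫ τ in (0:ℝ)..(2 * π), max 0 (-β τ)) /
          (Real.exp (-(∫ s in (0:ℝ)..(2 * π), β s)) - 1) := by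
  intro t
  have hc : Continuous β := hβ.continuous
  have hden : 0 < Real.exp (-(∫ s in (0:ℝ)..(2 * π), β s)) - 1 :=
    sub_pos.2 (Real.one_lt_exp_iff.2 (neg_pos.2 hneg))
  have ht : t ≤ t + 2 * π := by linarith [pi_pos]
  have hprim : Continuous fun s => ∫ τ in s..t, β τ := by
    simp_rw [fun s => integral_symm (μ := volume) (f := β) t s]
    exact (continuous_primitive (fun a b => hc.intervalIntegrable a b) t).neg
  have hexp : IntervalIntegrable (fun s => Real.exp (∫ τ in s..t, β τ)) volume t (t + 2 * π) :=
    (Real.continuous_exp.comp hprim).intervalIntegrable _ _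
  have hlower : ∀ s ∈ Set.Icc t (t + 2 * π),
      Real.exp (-(∫ τ in (0:ℝ)..(2 * π), max 0 (β τ))) ≤ Real.exp (∫ τ in s..t, β τ) := by
    intro s hs
    rw [Real.exp_le_exp, integral_symm t s]
    exact neg_le_neg (integral_le_integral_posPart_of_periodic hc hper hs.1 hs.2)
  have hupper : ∀ s ∈ Set.Icc t (t + 2 * π),
      Real.exp (∫ τ in s..t, β τ) ≤ Real.exp (∫ τ in (0:ℝ)..(2 * π), max 0 (-β τ)) := by
    intro s hs
    rw [Real.exp_le_exp, integral_symm t s, ← intervalIntegral.integral_neg]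
    exact integral_le_integral_posPart_of_periodic hc.neg
      (fun τ => congrArg Neg.neg (hper τ)) hs.1 hs.2
  have hl := integral_mono_on ht intervalIntegrable_const hexp hlower
  have hu := integral_mono_on ht hexp intervalIntegrable_const hupper
  simp only [intervalIntegral.integral_const, add_sub_cancel_left, smul_eq_mul] at hl hu
  rw [hy t]
  constructor <;> refine div_le_div_of_nonneg_right ?_ hden.le
  · linarith [mul_le_mul_of_nonneg_left hl hα.le]
  · linarith [mul_le_mul_of_nonneg_left hu hα.le]
end

section
/- For every D, L > 0 the set X'_ν(D,L) is a geodesically convex subset of (X_ν, d₂): if p₀, p₁ ∈ X'_ν(D,L) and u ∈ [0,1], then (1−u)p₀ ⊕ u p₁ ∈ X'_ν(D,L). -/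
set_option autoImplicit false

open MeasureTheory Set Real Filter

noncomputable section

/-- The (topological) support of a measure: points all of whose open neighborhoods
have positive measure. -/
def msupp {E : Type*} [TopologicalSpace E] [MeasurableSpace E] (μ : Measure E) : Set E :=
  {z | ∀ U : Set E, IsOpen U → z ∈ U → μ U ≠ 0}

/-- `π` is a coupling of `μ` and `ν`. -/
def IsCoupling {E F : Type*} [MeasurableSpace E] [MeasurableSpace F]
    (pl : Measure (E × F)) (μ : Measure E) (ν : Measure F) : Prop :=
  pl.map Prod.fst = μ ∧ pl.map Prod.snd = ν

/-- The 2-Wasserstein distance. -/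
def W2 {E : Type*} [MeasurableSpace E] [PseudoMetricSpace E] (μ ν : Measure E) : ℝ :=
  ⨅ pl : {pl : Measure (E × E) // IsCoupling pl μ ν},
    Real.sqrt (∫ q, dist q.1 q.2 ^ 2 ∂(pl.1))

/-- The conditional pseudo-inverse cumulative distribution function
`F⁻¹_η(s) = inf {x | η(−∞,x] ≥ s}`. -/
def qf (η : Measure ℝ) (s : ℝ) : ℝ := sInf {x : ℝ | s ≤ (η (Iic x)).toReal}

/-- Membership in `X_ν`: Markov kernels (represented as measurable families of
probability measures on `ℝ`) with finite second moments. -/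
def MemXnu (p : ℝ → Measure ℝ) : Prop :=
  (∀ ω, IsProbabilityMeasure (p ω)) ∧
  (∀ A : Set ℝ, MeasurableSet A → Measurable fun ω => p ω A) ∧
  (∀ ω, Integrable (fun x : ℝ => x ^ 2) (p ω))

/-- The metric `d₂` on `X_ν`. -/
def d2 (ν : Measure ℝ) (p q : ℝ → Measure ℝ) : ℝ :=
  Real.sqrt (∫ ω, W2 (p ω) (q ω) ^ 2 ∂ν)

/-- The path `u ↦ (1−u) p₀ ⊕ u p₁` given by the displacement interpolation of the
pseudo-inverse cumulative distribution functions: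
`((1−u) p₀ ⊕ u p₁)(·,ω) = ((1−u) F⁻¹_{p₀}(·,ω) + u F⁻¹_{p₁}(·,ω))_♯ L` with `L`
Lebesgue measure on `(0,1)`. -/
def geod (p₀ p₁ : ℝ → Measure ℝ) (u : ℝ) : ℝ → Measure ℝ :=
  fun ω => Measure.map (fun s => (1 - u) * qf (p₀ ω) s + u * qf (p₁ ω) s)
    (volume.restrict (Ioo (0:ℝ) 1))

/-- Membership in `X'_ν(D,L)`. -/
def MemX' (ν : Measure ℝ) (D L : ℝ) (p : ℝ → Measure ℝ) : Prop :=
  MemXnu p ∧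
  (∫ ω, (∫ x, x ∂(p ω)) ∂ν) = 0 ∧
  (∀ ω ∈ msupp ν, ∀ ω' ∈ msupp ν, ∀ x ∈ msupp (p ω), ∀ x' ∈ msupp (p ω'),
    |x - x'| ≤ D) ∧
  (∀ ω ∈ msupp ν, ∀ ω' ∈ msupp ν, W2 (p ω) (p ω') ≤ L * |ω - ω'|)

/-- Lebesgue measure on the open unit interval. -/
abbrev unitVolume : Measure ℝ := volume.restrict (Ioo (0:ℝ) 1)

instance isProbabilityMeasure_unitVolume : IsProbabilityMeasure unitVolume :=
  ⟨by simp [unitVolume]⟩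

theorem qf_le_iff (μ : Measure ℝ) [IsProbabilityMeasure μ] {s : ℝ} (hs : s ∈ Ioo (0:ℝ) 1)
    (x : ℝ) : qf μ s ≤ x ↔ s ≤ (μ (Iic x)).toReal := by
  have hF : ∀ y, (μ (Iic y)).toReal = ProbabilityTheory.cdf μ y := fun y =>
    (ProbabilityTheory.cdf_eq_real μ y).symm
  simp only [qf, hF]
  set F := ProbabilityTheory.cdf μ
  have hbdd : BddBelow {y : ℝ | s ≤ F y} := by
    obtain ⟨b, hb⟩ := ((ProbabilityTheory.tendsto_cdf_atBot μ).eventually_lt_const hs.1).exists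
    refine ⟨b, fun y hy => ?_⟩
    by_contra! h
    exact absurd (hy.trans (F.mono h.le)) (not_le.2 hb)
  have hne : {y : ℝ | s ≤ F y}.Nonempty := by
    obtain ⟨b, hb⟩ := ((ProbabilityTheory.tendsto_cdf_atTop μ).eventually_const_lt hs.2).exists
    exact ⟨b, hb.le⟩
  refine ⟨fun h => ?_, fun h => csInf_le hbdd h⟩
  refine le_trans ?_ (F.mono h)
  have hlim := (F.right_continuous (sInf {y : ℝ | s ≤ F y})).tendsto.mono_left
    (nhdsWithin_mono _ Ioi_subset_Ici_self)
  refine ge_of_tendsto hlim (eventually_mem_nhdsWithin.mono fun y hy => ?_)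
  obtain ⟨z, hz, hzy⟩ := exists_lt_of_csInf_lt hne hy
  exact le_trans hz (F.mono hzy.le)

theorem measurable_indicator_qf {p : ℝ → Measure ℝ} (hp : ∀ ω, IsProbabilityMeasure (p ω))
    (hm : ∀ A : Set ℝ, MeasurableSet A → Measurable fun ω => p ω A) :
    Measurable fun z : ℝ × ℝ => (Ioo (0:ℝ) 1).indicator (qf (p z.1)) z.2 := by
  refine measurable_of_Iic fun x => ?_
  have h : (fun z : ℝ × ℝ => (Ioo (0:ℝ) 1).indicator (qf (p z.1)) z.2) ⁻¹' Iic x =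
      ({z | z.2 ∈ Ioo (0:ℝ) 1} ∩ {z | z.2 ≤ (p z.1 (Iic x)).toReal}) ∪
        ({z | z.2 ∈ Ioo (0:ℝ) 1}ᶜ ∩ {_z | 0 ≤ x}) := by
    ext z
    by_cases hz : z.2 ∈ Ioo (0:ℝ) 1
    · simp only [mem_preimage, indicator_of_mem hz, mem_Iic, qf_le_iff _ hz, mem_union, mem_inter_iff,
        mem_ofPred_eq, mem_compl_iff, hz, not_true_eq_false, true_and, false_and, or_false]
    · simp only [mem_preimage, indicator_of_notMem hz, mem_Iic, mem_union, mem_inter_iff,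
        mem_ofPred_eq, mem_compl_iff, hz, not_false_eq_true, true_and, false_and, false_or]
  rw [h]
  have h1 : MeasurableSet {z : ℝ × ℝ | z.2 ∈ Ioo (0:ℝ) 1} := measurable_snd measurableSet_Ioo
  have h2 : Measurable fun z : ℝ × ℝ => (p z.1 (Iic x)).toReal :=
    ((hm _ measurableSet_Iic).comp measurable_fst).ennreal_toReal
  exact (h1.inter (measurableSet_le measurable_snd h2)).union
    (h1.compl.inter (MeasurableSet.const _))

theorem aemeasurable_qf (μ : Measure ℝ) [IsProbabilityMeasure μ] :
    AEMeasurable (qf μ) unitVolume := by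
  have h := (measurable_indicator_qf (p := fun _ => μ) (fun _ => inferInstance)
    fun _ _ => measurable_const).comp (measurable_prodMk_left (x := (0:ℝ)))
  refine ⟨_, h, ?_⟩
  filter_upwards [ae_restrict_mem measurableSet_Ioo] with s hs
  simp [hs]

theorem map_qf (μ : Measure ℝ) [IsProbabilityMeasure μ] : unitVolume.map (qf μ) = μ := by
  have := Measure.isProbabilityMeasure_map (aemeasurable_qf μ)
  refine Measure.ext_of_Iic _ _ fun x => ?_
  rw [Measure.map_apply_of_aemeasurable (aemeasurable_qf μ) measurableSet_Iic,
    Measure.restrict_apply' measurableSet_Ioo]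
  have h : qf μ ⁻¹' Iic x ∩ Ioo 0 1 = Iic (μ (Iic x)).toReal ∩ Ioo 0 1 := by
    ext s
    simp only [mem_inter_iff, mem_preimage, mem_Iic, and_congr_left_iff]
    exact fun hs => qf_le_iff μ hs x
  have h' : (μ (Iic x)).toReal ≤ 1 := measureReal_le_one
  have hcap : Iic (μ (Iic x)).toReal ∩ Ioc 0 1 = Ioc 0 (μ (Iic x)).toReal := by
    ext s
    simp only [mem_inter_iff, mem_Iic, mem_Ioc]
    exact ⟨fun hs => ⟨hs.2.1, hs.1⟩, fun hs => ⟨hs.2, hs.1, hs.2.trans h'⟩⟩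
  have hae : (Iic (μ (Iic x)).toReal ∩ Ioo 0 1 : Set ℝ) =ᵐ[volume]
      (Iic (μ (Iic x)).toReal ∩ Ioc 0 1 : Set ℝ) :=
    (ae_eq_refl (Iic (μ (Iic x)).toReal)).inter Ioo_ae_eq_Ioc
  rw [h, measure_congr hae, hcap, Real.volume_Ioc, sub_zero,
    ENNReal.ofReal_toReal (measure_ne_top _ _)]

/-- A layer-cake formula for the positive part of a difference, squared. -/
theorem lintegral_ofReal_sub_sq {Ω : Type*} [MeasurableSpace Ω] (P : Measure Ω)
    [IsProbabilityMeasure P] {X Y : Ω → ℝ} (hX : AEMeasurable X P) (hY : AEMeasurable Y P) :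
    ∫⁻ ω, ENNReal.ofReal (Y ω - X ω) ^ 2 ∂P =
      ∫⁻ z : ℝ × ℝ, P {ω | X ω ≤ min z.1 z.2 ∧ max z.1 z.2 < Y ω} := by
  wlog hXY : Measurable X ∧ Measurable Y generalizing X Y
  · have h := this hX.measurable_mk.aemeasurable hY.measurable_mk.aemeasurable
      ⟨hX.measurable_mk, hY.measurable_mk⟩
    have e : ∀ᵐ ω ∂P, X ω = hX.mk X ω ∧ Y ω = hY.mk Y ω := hX.ae_eq_mk.and hY.ae_eq_mk
    rw [lintegral_congr_ae (e.mono fun ω h => by simp only [h.1, h.2]; rfl), h]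
    refine lintegral_congr fun z => measure_congr (Filter.eventuallyEq_set.2 ?_)
    filter_upwards [e] with ω h
    simp only [h.1, h.2]
  obtain ⟨hX, hY⟩ := hXY
  let E : Set (Ω × (ℝ × ℝ)) :=
    {w | X w.1 ≤ min w.2.1 w.2.2 ∧ max w.2.1 w.2.2 < Y w.1}
  have hE : MeasurableSet E :=
    (measurableSet_le (f := fun w : Ω × (ℝ × ℝ) => X w.1) (g := fun w => min w.2.1 w.2.2)
      (by fun_prop) (by fun_prop)).inter
      (measurableSet_lt (f := fun w : Ω × (ℝ × ℝ) => max w.2.1 w.2.2) (g := fun w => Y w.1)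
        (by fun_prop) (by fun_prop))
  have h1 := Measure.prod_apply (μ := P) (ν := (volume : Measure (ℝ × ℝ))) hE
  have h2 := Measure.prod_apply_symm (μ := P) (ν := (volume : Measure (ℝ × ℝ))) hE
  rw [h1] at h2
  rw [show (∫⁻ z : ℝ × ℝ, P {ω | X ω ≤ min z.1 z.2 ∧ max z.1 z.2 < Y ω}) =
    ∫⁻ z : ℝ × ℝ, P ((fun ω => (ω, z)) ⁻¹' E) from rfl, ← h2]
  refine lintegral_congr fun ω => ?_
  have h3 : Prod.mk ω ⁻¹' E = Ico (X ω) (Y ω) ×ˢ Ico (X ω) (Y ω) := by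
    ext z
    simp only [E, mem_preimage, mem_ofPred_eq, mem_prod, mem_Ico, le_min_iff, max_lt_iff]
    tauto
  rw [h3, Measure.volume_eq_prod, Measure.prod_prod, Real.volume_Ico, sq]

theorem lintegral_ofReal_qf_sub_sq_le {Ω : Type*} [MeasurableSpace Ω] (P : Measure Ω)
    [IsProbabilityMeasure P] {X Y : Ω → ℝ} (hX : Measurable X) (hY : Measurable Y)
    {μ ν : Measure ℝ} [IsProbabilityMeasure μ] [IsProbabilityMeasure ν]
    (hμ : P.map X = μ) (hν : P.map Y = ν) :
    ∫⁻ s, ENNReal.ofReal (qf ν s - qf μ s) ^ 2 ∂unitVolume ≤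
      ∫⁻ ω, ENNReal.ofReal (Y ω - X ω) ^ 2 ∂P := by
  rw [lintegral_ofReal_sub_sq _ (aemeasurable_qf μ) (aemeasurable_qf ν),
    lintegral_ofReal_sub_sq _ hX.aemeasurable hY.aemeasurable]
  refine lintegral_mono fun z => ?_
  set m := min z.1 z.2
  set M := max z.1 z.2
  have hP : P {ω | X ω ≤ m} = μ (Iic m) := by
    rw [← hμ, Measure.map_apply hX measurableSet_Iic]; rfl
  have hP' : P {ω | Y ω ≤ M} = ν (Iic M) := by
    rw [← hν, Measure.map_apply hY measurableSet_Iic]; rfl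
  calc unitVolume {s | qf μ s ≤ m ∧ M < qf ν s}
      ≤ volume (Ioc (ν (Iic M)).toReal (μ (Iic m)).toReal) := by
        rw [Measure.restrict_apply' measurableSet_Ioo]
        refine measure_mono fun s hs => ?_
        obtain ⟨⟨h1, h2⟩, h3⟩ := hs
        rw [← not_le, qf_le_iff _ h3, not_le] at h2
        exact ⟨h2, (qf_le_iff _ h3 _).1 h1⟩
    _ = μ (Iic m) - ν (Iic M) := by
        rw [Real.volume_Ioc, ENNReal.ofReal_sub _ ENNReal.toReal_nonneg,
          ENNReal.ofReal_toReal (measure_ne_top _ _), ENNReal.ofReal_toReal (measure_ne_top _ _)]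
    _ ≤ P {ω | X ω ≤ m ∧ M < Y ω} := by
        rw [tsub_le_iff_right, ← hP, ← hP']
        refine (measure_mono fun ω hω => ?_).trans (measure_union_le _ _)
        rcases le_or_gt (Y ω) M with h | h
        · exact Or.inr h
        · exact Or.inl ⟨hω, h⟩

theorem ofReal_sub_sq (x y : ℝ) :
    ENNReal.ofReal ((x - y) ^ 2) = ENNReal.ofReal (x - y) ^ 2 + ENNReal.ofReal (y - x) ^ 2 := by
  rcases le_total x y with h | h
  · rw [ENNReal.ofReal_of_nonpos (sub_nonpos.2 h), ← ENNReal.ofReal_pow (sub_nonneg.2 h)]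
    rw [zero_pow two_ne_zero, zero_add, ← neg_sub y x, neg_sq]
  · rw [ENNReal.ofReal_of_nonpos (sub_nonpos.2 h), ENNReal.ofReal_pow (sub_nonneg.2 h)]
    simp

/-- The monotone coupling has the least quadratic cost. -/
theorem lintegral_qf_sub_sq_le {pl : Measure (ℝ × ℝ)} {μ ν : Measure ℝ} [IsProbabilityMeasure μ]
    [IsProbabilityMeasure ν] (h : IsCoupling pl μ ν) :
    ∫⁻ s, ENNReal.ofReal ((qf μ s - qf ν s) ^ 2) ∂unitVolume ≤
      ∫⁻ q, ENNReal.ofReal ((q.1 - q.2) ^ 2) ∂pl := by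
  have : IsProbabilityMeasure pl := by
    have h1 : IsProbabilityMeasure (pl.map Prod.fst) := by rw [h.1]; infer_instance
    exact Measure.isProbabilityMeasure_of_map Prod.fst
  simp only [ofReal_sub_sq]
  rw [lintegral_add_left' (by have := aemeasurable_qf μ; have := aemeasurable_qf ν; fun_prop),
    lintegral_add_left (by fun_prop)]
  exact add_le_add
    (lintegral_ofReal_qf_sub_sq_le pl measurable_snd measurable_fst h.2 h.1)
    (lintegral_ofReal_qf_sub_sq_le pl measurable_fst measurable_snd h.1 h.2)

theorem isCoupling_map {μ ν : Measure ℝ} {f g : ℝ → ℝ} (hf : AEMeasurable f unitVolume)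
    (hg : AEMeasurable g unitVolume) (hμ : unitVolume.map f = μ) (hν : unitVolume.map g = ν) :
    IsCoupling (unitVolume.map fun s => (f s, g s)) μ ν := by
  constructor
  · rw [AEMeasurable.map_map_of_aemeasurable measurable_fst.aemeasurable (hf.prodMk hg), ← hμ]
    rfl
  · rw [AEMeasurable.map_map_of_aemeasurable measurable_snd.aemeasurable (hf.prodMk hg), ← hν]
    rfl

theorem W2_map_le {f g : ℝ → ℝ} (hf : AEMeasurable f unitVolume)
    (hg : AEMeasurable g unitVolume) :
    W2 (unitVolume.map f) (unitVolume.map g) ≤ √(∫ s, (f s - g s) ^ 2 ∂unitVolume) := by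
  refine (ciInf_le ⟨0, ?_⟩ ⟨_, isCoupling_map hf hg rfl rfl⟩).trans_eq ?_
  · rintro _ ⟨pl, rfl⟩
    exact Real.sqrt_nonneg _
  · simp only
    rw [integral_map (hf.prodMk hg) (by fun_prop)]
    simp [Real.dist_eq]

theorem memLp_qf {μ : Measure ℝ} [IsProbabilityMeasure μ]
    (hμ : Integrable (fun x : ℝ => x ^ 2) μ) : MemLp (qf μ) 2 unitVolume := by
  have h : MemLp (id : ℝ → ℝ) 2 μ :=
    (memLp_two_iff_integrable_sq aestronglyMeasurable_id).2 hμ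
  rw [← map_qf μ] at h
  exact h.comp_of_map (aemeasurable_qf μ)

theorem sqrt_integral_qf_sub_sq_le_W2 {μ ν : Measure ℝ} [IsProbabilityMeasure μ]
    [IsProbabilityMeasure ν] (hμ : Integrable (fun x : ℝ => x ^ 2) μ)
    (hν : Integrable (fun x : ℝ => x ^ 2) ν) :
    √(∫ s, (qf μ s - qf ν s) ^ 2 ∂unitVolume) ≤ W2 μ ν := by
  have : Nonempty {pl : Measure (ℝ × ℝ) // IsCoupling pl μ ν} :=
    ⟨⟨_, isCoupling_map (aemeasurable_qf μ) (aemeasurable_qf ν) (map_qf μ) (map_qf ν)⟩⟩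
  refine le_ciInf fun ⟨pl, hpl⟩ => Real.sqrt_le_sqrt ?_
  simp only [Real.dist_eq, sq_abs]
  have h1 : MemLp (fun q : ℝ × ℝ => q.1) 2 pl := by
    have h : MemLp (id : ℝ → ℝ) 2 (pl.map Prod.fst) := by
      rw [hpl.1]; exact (memLp_two_iff_integrable_sq aestronglyMeasurable_id).2 hμ
    exact h.comp_of_map measurable_fst.aemeasurable
  have h2 : MemLp (fun q : ℝ × ℝ => q.2) 2 pl := by
    have h : MemLp (id : ℝ → ℝ) 2 (pl.map Prod.snd) := by
      rw [hpl.2]; exact (memLp_two_iff_integrable_sq aestronglyMeasurable_id).2 hν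
    exact h.comp_of_map measurable_snd.aemeasurable
  have hi : Integrable (fun q : ℝ × ℝ => (q.1 - q.2) ^ 2) pl := (h1.sub h2).integrable_sq
  have hq : Integrable (fun s => (qf μ s - qf ν s) ^ 2) unitVolume :=
    ((memLp_qf hμ).sub (memLp_qf hν)).integrable_sq
  rw [← ENNReal.ofReal_le_ofReal_iff (integral_nonneg fun _ => sq_nonneg _),
    ofReal_integral_eq_lintegral_ofReal hq (ae_of_all _ fun _ => sq_nonneg _),
    ofReal_integral_eq_lintegral_ofReal hi (ae_of_all _ fun _ => sq_nonneg _)]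
  exact lintegral_qf_sub_sq_le hpl

theorem msupp_eq_support (μ : Measure ℝ) : msupp μ = μ.support := by
  ext x
  rw [Measure.mem_support_iff_forall]
  refine ⟨fun h U hU => ?_, fun h U hU hx => (h U (hU.mem_nhds hx)).ne'⟩
  obtain ⟨V, hVU, hV, hx⟩ := mem_nhds_iff.1 hU
  exact (pos_iff_ne_zero.2 (h V hV hx)).trans_le (measure_mono hVU)

theorem ae_mem_msupp (μ : Measure ℝ) : ∀ᵐ x ∂μ, x ∈ msupp μ := by
  rw [msupp_eq_support]
  exact Measure.support_mem_ae

theorem ae_qf_mem_msupp (μ : Measure ℝ) [IsProbabilityMeasure μ] :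
    ∀ᵐ s ∂unitVolume, qf μ s ∈ msupp μ :=
  ae_of_ae_map (aemeasurable_qf μ) (by rw [map_qf]; exact ae_mem_msupp μ)

theorem exists_abs_sub_lt_of_mem_msupp_map {f : ℝ → ℝ} (hf : AEMeasurable f unitVolume)
    {P : ℝ → Prop} (hP : ∀ᵐ s ∂unitVolume, P s) {x : ℝ} (hx : x ∈ msupp (unitVolume.map f))
    {ε : ℝ} (hε : 0 < ε) : ∃ s, P s ∧ |f s - x| < ε := by
  have h := hx (Metric.ball x ε) Metric.isOpen_ball (Metric.mem_ball_self hε)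
  rw [Measure.map_apply_of_aemeasurable hf measurableSet_ball] at h
  obtain ⟨s, hs, hPs⟩ := ((frequently_ae_mem_iff.2 h).and_eventually hP).exists
  exact ⟨s, hPs, hs⟩

section Geodesic

variable {p₀ p₁ : ℝ → Measure ℝ} {u : ℝ}

theorem memLp_geod (h₀ : MemXnu p₀) (h₁ : MemXnu p₁) (ω : ℝ) :
    MemLp (fun s => (1 - u) * qf (p₀ ω) s + u * qf (p₁ ω) s) 2 unitVolume := by
  have := h₀.1 ω
  have := h₁.1 ω
  exact ((memLp_qf (h₀.2.2 ω)).const_mul _).add ((memLp_qf (h₁.2.2 ω)).const_mul _)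

theorem memXnu_geod (h₀ : MemXnu p₀) (h₁ : MemXnu p₁) : MemXnu (geod p₀ p₁ u) := by
  refine ⟨fun ω => Measure.isProbabilityMeasure_map (memLp_geod h₀ h₁ ω).1.aemeasurable,
    fun A hA => ?_, fun ω => ?_⟩
  · have hT : Measurable fun z : ℝ × ℝ => (1 - u) * (Ioo (0:ℝ) 1).indicator (qf (p₀ z.1)) z.2 +
        u * (Ioo (0:ℝ) 1).indicator (qf (p₁ z.1)) z.2 :=
      ((measurable_indicator_qf h₀.1 h₀.2.1).const_mul _).add
        ((measurable_indicator_qf h₁.1 h₁.2.1).const_mul _)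
    convert measurable_measure_prodMk_left (ν := unitVolume) (hT hA) using 2 with ω
    rw [geod, Measure.map_apply_of_aemeasurable (memLp_geod h₀ h₁ ω).1.aemeasurable hA]
    refine measure_congr (Filter.eventuallyEq_set.2 ?_)
    filter_upwards [ae_restrict_mem measurableSet_Ioo] with s hs
    simp only [mem_preimage, indicator_of_mem hs]
  · rw [geod, integrable_map_measure (by fun_prop) (memLp_geod h₀ h₁ ω).1.aemeasurable]
    exact (memLp_geod h₀ h₁ ω).integrable_sq

theorem integral_geod (h₀ : MemXnu p₀) (h₁ : MemXnu p₁) (ω : ℝ) :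
    ∫ x, x ∂(geod p₀ p₁ u ω) = (1 - u) * ∫ x, x ∂(p₀ ω) + u * ∫ x, x ∂(p₁ ω) := by
  have := h₀.1 ω
  have := h₁.1 ω
  have hq : ∀ μ : Measure ℝ, IsProbabilityMeasure μ → ∫ x, x ∂μ = ∫ s, qf μ s ∂unitVolume := by
    intro μ _
    conv_lhs => rw [← map_qf μ]
    exact integral_map (aemeasurable_qf μ) (by fun_prop)
  rw [geod, integral_map (memLp_geod h₀ h₁ ω).1.aemeasurable (by fun_prop), hq (p₀ ω) (h₀.1 ω),
    hq (p₁ ω) (h₁.1 ω), integral_add, integral_const_mul, integral_const_mul]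
  · exact ((memLp_qf (h₀.2.2 ω)).integrable one_le_two).const_mul _
  · exact ((memLp_qf (h₁.2.2 ω)).integrable one_le_two).const_mul _

theorem abs_sub_le_of_mem_msupp_geod (h₀ : MemXnu p₀) (h₁ : MemXnu p₁) (hu : u ∈ Icc (0:ℝ) 1)
    {D ω ω' : ℝ} (hD₀ : ∀ x ∈ msupp (p₀ ω), ∀ x' ∈ msupp (p₀ ω'), |x - x'| ≤ D)
    (hD₁ : ∀ x ∈ msupp (p₁ ω), ∀ x' ∈ msupp (p₁ ω'), |x - x'| ≤ D) {x x' : ℝ}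
    (hx : x ∈ msupp (geod p₀ p₁ u ω)) (hx' : x' ∈ msupp (geod p₀ p₁ u ω')) : |x - x'| ≤ D := by
  have hsupp : ∀ η, ∀ᵐ s ∂unitVolume, qf (p₀ η) s ∈ msupp (p₀ η) ∧ qf (p₁ η) s ∈ msupp (p₁ η) := by
    intro η
    have := h₀.1 η
    have := h₁.1 η
    exact (ae_qf_mem_msupp _).and (ae_qf_mem_msupp _)
  refine le_of_forall_pos_le_add fun ε hε => ?_
  obtain ⟨s, ⟨hs₀, hs₁⟩, hs⟩ := exists_abs_sub_lt_of_mem_msupp_map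
    (memLp_geod h₀ h₁ ω).1.aemeasurable (hsupp ω) hx (half_pos hε)
  obtain ⟨t, ⟨ht₀, ht₁⟩, ht⟩ := exists_abs_sub_lt_of_mem_msupp_map
    (memLp_geod h₀ h₁ ω').1.aemeasurable (hsupp ω') hx' (half_pos hε)
  have e₀ := abs_le.1 (hD₀ _ hs₀ _ ht₀)
  have e₁ := abs_le.1 (hD₁ _ hs₁ _ ht₁)
  rw [abs_lt] at hs ht
  obtain ⟨hu0, hu1⟩ := hu
  rw [abs_le]
  constructor <;> nlinarith [mul_le_mul_of_nonneg_left e₀.1 (sub_nonneg.2 hu1),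
    mul_le_mul_of_nonneg_left e₀.2 (sub_nonneg.2 hu1), mul_le_mul_of_nonneg_left e₁.1 hu0,
    mul_le_mul_of_nonneg_left e₁.2 hu0]

theorem W2_geod_le (h₀ : MemXnu p₀) (h₁ : MemXnu p₁) (hu : u ∈ Icc (0:ℝ) 1) {K ω ω' : ℝ}
    (hK₀ : W2 (p₀ ω) (p₀ ω') ≤ K) (hK₁ : W2 (p₁ ω) (p₁ ω') ≤ K) :
    W2 (geod p₀ p₁ u ω) (geod p₀ p₁ u ω') ≤ K := by
  have bound : ∀ p : ℝ → Measure ℝ, MemXnu p → W2 (p ω) (p ω') ≤ K →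
      Integrable (fun s => (qf (p ω) s - qf (p ω') s) ^ 2) unitVolume ∧ 0 ≤ K ∧
        ∫ s, (qf (p ω) s - qf (p ω') s) ^ 2 ∂unitVolume ≤ K ^ 2 := by
    intro p hp hK
    have := hp.1 ω
    have := hp.1 ω'
    have h := (sqrt_integral_qf_sub_sq_le_W2 (hp.2.2 ω) (hp.2.2 ω')).trans hK
    exact ⟨((memLp_qf (hp.2.2 ω)).sub (memLp_qf (hp.2.2 ω'))).integrable_sq,
      (Real.sqrt_nonneg _).trans h, (Real.sqrt_le_left ((Real.sqrt_nonneg _).trans h)).1 h⟩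
  obtain ⟨i₀, hK, b₀⟩ := bound p₀ h₀ hK₀
  obtain ⟨i₁, -, b₁⟩ := bound p₁ h₁ hK₁
  refine (W2_map_le (memLp_geod h₀ h₁ ω).1.aemeasurable
    (memLp_geod h₀ h₁ ω').1.aemeasurable).trans (Real.sqrt_le_iff.2 ⟨hK, ?_⟩)
  obtain ⟨hu0, hu1⟩ := hu
  calc _ ≤ ∫ s, ((1 - u) * (qf (p₀ ω) s - qf (p₀ ω') s) ^ 2 +
        u * (qf (p₁ ω) s - qf (p₁ ω') s) ^ 2) ∂unitVolume := by
        refine integral_mono ((memLp_geod h₀ h₁ ω).sub (memLp_geod h₀ h₁ ω')).integrable_sq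
          ((i₀.const_mul _).add (i₁.const_mul _)) fun s => ?_
        nlinarith [mul_nonneg (mul_nonneg hu0 (sub_nonneg.2 hu1))
          (sq_nonneg (qf (p₀ ω) s - qf (p₀ ω') s - (qf (p₁ ω) s - qf (p₁ ω') s)))]
    _ = (1 - u) * ∫ s, (qf (p₀ ω) s - qf (p₀ ω') s) ^ 2 ∂unitVolume +
        u * ∫ s, (qf (p₁ ω) s - qf (p₁ ω') s) ^ 2 ∂unitVolume := by
        rw [integral_add (i₀.const_mul _) (i₁.const_mul _), integral_const_mul,
          integral_const_mul]
    _ ≤ K ^ 2 := by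
        nlinarith [mul_le_mul_of_nonneg_left b₀ (sub_nonneg.2 hu1),
          mul_le_mul_of_nonneg_left b₁ hu0]

end Geodesic

theorem MemX'.integrable_mean {ν : Measure ℝ} [IsProbabilityMeasure ν] {D L : ℝ}
    {p : ℝ → Measure ℝ} (h : MemX' ν D L p) : Integrable (fun ω => ∫ x, x ∂(p ω)) ν := by
  obtain ⟨⟨hp, hm, hi⟩, -, hD, -⟩ := h
  let κ : ProbabilityTheory.Kernel ℝ ℝ := ⟨p, Measure.measurable_of_measurable_coe _ hm⟩
  have hκ : ProbabilityTheory.IsMarkovKernel κ := ⟨hp⟩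
  have hmeas : AEStronglyMeasurable (fun ω => ∫ x, x ∂(p ω)) ν :=
    (StronglyMeasurable.integral_kernel (κ := κ) (f := fun x => x)
      stronglyMeasurable_id).aestronglyMeasurable
  obtain ⟨ω₀, hω₀⟩ := (ae_mem_msupp ν).exists
  obtain ⟨x₀, hx₀⟩ := (ae_mem_msupp (p ω₀)).exists
  refine Integrable.of_bound hmeas (D + |x₀|) ((ae_mem_msupp ν).mono fun ω hω => ?_)
  have hb : ∀ᵐ x ∂(p ω), ‖x‖ ≤ D + |x₀| := by
    filter_upwards [ae_mem_msupp (p ω)] with x hx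
    have := hD ω hω ω₀ hω₀ x hx x₀ hx₀
    rw [Real.norm_eq_abs]
    linarith [abs_sub_abs_le_abs_sub x x₀]
  simpa using norm_integral_le_of_norm_le_const hb

/-- For every `D, L > 0` the set `X'_ν(D,L)` is a geodesically convex
subset of `(X_ν, d₂)`: if `p₀, p₁ ∈ X'_ν(D,L)` and `u ∈ [0,1]`, then
`(1−u) p₀ ⊕ u p₁ ∈ X'_ν(D,L)`. -/
theorem Xnu_prime_geodesically_convex
    (ν : Measure ℝ) [IsProbabilityMeasure ν]
    (hν2 : Integrable (fun x : ℝ => x ^ 2) ν)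
    (hΩ : Bornology.IsBounded (msupp ν))
    (D L : ℝ) (hD : 0 < D) (hL : 0 < L)
    (p₀ p₁ : ℝ → Measure ℝ) (h₀ : MemX' ν D L p₀) (h₁ : MemX' ν D L p₁)
    (u : ℝ) (hu : u ∈ Icc (0:ℝ) 1) :
    MemX' ν D L (geod p₀ p₁ u) := by
  refine ⟨memXnu_geod h₀.1 h₁.1, ?_, fun ω hω ω' hω' x hx x' hx' => ?_, fun ω hω ω' hω' => ?_⟩
  · simp only [integral_geod h₀.1 h₁.1]
    rw [integral_add (h₀.integrable_mean.const_mul _) (h₁.integrable_mean.const_mul _),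
      integral_const_mul, integral_const_mul, h₀.2.1, h₁.2.1]
    simp
  · exact abs_sub_le_of_mem_msupp_geod h₀.1 h₁.1 hu (h₀.2.2.1 ω hω ω' hω')
      (h₁.2.2.1 ω hω ω' hω') hx hx'
  · exact W2_geod_le h₀.1 h₁.1 hu (h₀.2.2.2 ω hω ω' hω') (h₁.2.2.2 ω hω ω' hω')
end
end
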